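/- Straszewicz–Klee theorem for matrix convex sets: let V be a normed complex vector space and let K = (K_n)_{n≥1} be a matrix convex set in V such that K₁ is nonempty and each K_n is compact. Then K has at least one matrix exposed point, and K is the closed matrix convex hull of its matrix exposed points: for every n ≥ 1, K_n equals the closure in M_n(V) of the set of all matrix convex combinations Σ_i γ_i* A_i γ_i ∈ M_n(V), where each A_i ∈ K_{n_i} is a matrix exposed point of K and the γ_i are complex n_i × n matrices with Σ_i γ_i* γ_i = I_n. -/

import Mathlib

open scoped Matrix Kronecker ComplexOrder

noncomputable section

variable {V : Type*} [AddCommGroup V] [Module ℂ V]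

/-- The matrix `γ* A γ` computed entrywise via the `ℂ`-action on `V`. -/
def mconj {m n : ℕ} (γ : Matrix (Fin m) (Fin n) ℂ)
    (A : Matrix (Fin m) (Fin m) V) : Matrix (Fin n) (Fin n) V :=
  Matrix.of fun i j => ∑ k, ∑ l, (star (γ k i) * γ l j) • A k l

/-- A graded family `K = (K_n)` is a matrix convex set. -/
def IsMatrixConvex (K : ∀ n : ℕ, Set (Matrix (Fin n) (Fin n) V)) : Prop :=
  ∀ (k n : ℕ), 0 < k → 0 < n →
    ∀ (ns : Fin k → ℕ) (A : ∀ i : Fin k, Matrix (Fin (ns i)) (Fin (ns i)) V)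
      (γ : ∀ i : Fin k, Matrix (Fin (ns i)) (Fin n) ℂ),
      (∀ i, 0 < ns i) → (∀ i, A i ∈ K (ns i)) →
      (∑ i, (γ i)ᴴ * γ i) = 1 →
      (∑ i, mconj (γ i) (A i)) ∈ K n

/-- The `r`-th ampliation of `Φ : V → M_m(ℂ)` applied to `B ∈ M_r(V)`, as a matrix
indexed by `Fin m × Fin r` (block `(i,j)`, inner indices `(p,q)` ↦ `Φ (B i j) p q`). -/
def amplify {m r : ℕ} (Φ : V → Matrix (Fin m) (Fin m) ℂ)
    (B : Matrix (Fin r) (Fin r) V) : Matrix (Fin m × Fin r) (Fin m × Fin r) ℂ :=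
  Matrix.of fun p q => Φ (B p.2 q.2) p.1 q.1

/-- Hermitian part `(X + X*)/2` of a complex matrix. -/
def reM {ι : Type*} (X : Matrix ι ι ℂ) : Matrix ι ι ℂ := (2 : ℂ)⁻¹ • (X + Xᴴ)

section Top

variable [TopologicalSpace V]

/-- `(Φ, α)` matricially exposes the point `A ∈ K_n`. -/
def IsExposingPair (K : ∀ n : ℕ, Set (Matrix (Fin n) (Fin n) V)) {n : ℕ}
    (A : Matrix (Fin n) (Fin n) V)
    (Φ : V →L[ℂ] Matrix (Fin n) (Fin n) ℂ) (α : Matrix (Fin n) (Fin n) ℂ) : Prop :=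
  α.IsHermitian ∧
  (∀ r : ℕ, 0 < r → ∀ B ∈ K r,
    (α ⊗ₖ (1 : Matrix (Fin r) (Fin r) ℂ) - reM (amplify (⇑Φ) B)).PosSemidef) ∧
  {B | B ∈ K n ∧
      (α ⊗ₖ (1 : Matrix (Fin n) (Fin n) ℂ) - reM (amplify (⇑Φ) B)).PosSemidef ∧
      ¬ IsUnit (α ⊗ₖ (1 : Matrix (Fin n) (Fin n) ℂ) - reM (amplify (⇑Φ) B))} =
    {B | ∃ U ∈ Matrix.unitaryGroup (Fin n) ℂ, B = mconj U A}

/-- `A ∈ K_n` is a matrix exposed point of `K`. -/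
def IsMatrixExposed (K : ∀ n : ℕ, Set (Matrix (Fin n) (Fin n) V)) {n : ℕ}
    (A : Matrix (Fin n) (Fin n) V) : Prop :=
  ∃ (Φ : V →L[ℂ] Matrix (Fin n) (Fin n) ℂ) (α : Matrix (Fin n) (Fin n) ℂ),
    IsExposingPair K A Φ α

end Top

/-- Classical exposed point of a set in a topological `ℂ`-vector space. -/
def IsExposedPoint {W : Type*} [AddCommGroup W] [Module ℂ W] [TopologicalSpace W]
    (C : Set W) (x : W) : Prop :=
  x ∈ C ∧ ∃ (φ : W →L[ℂ] ℂ) (a : ℝ),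
    (φ x).re = a ∧ ∀ y ∈ C, y ≠ x → (φ y).re < a

/-- Classical exposed face of a set in a topological `ℂ`-vector space. -/
def IsExposedFaceOf {W : Type*} [AddCommGroup W] [Module ℂ W] [TopologicalSpace W]
    (C F : Set W) : Prop :=
  F ⊆ C ∧ ∃ (φ : W →L[ℂ] ℂ) (a : ℝ),
    (∀ x ∈ F, (φ x).re = a) ∧ ∀ y ∈ C, y ∉ F → (φ y).re < a

/-- `A ∈ K_n` is a matrix extreme point of the graded family `K`. -/
def IsMatrixExtreme (K : ∀ n : ℕ, Set (Matrix (Fin n) (Fin n) V)) {n : ℕ}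
    (A : Matrix (Fin n) (Fin n) V) : Prop :=
  A ∈ K n ∧
  ∀ (k : ℕ), 0 < k →
    ∀ (ns : Fin k → ℕ) (Ai : ∀ i : Fin k, Matrix (Fin (ns i)) (Fin (ns i)) V)
      (γ : ∀ i : Fin k, Matrix (Fin (ns i)) (Fin n) ℂ),
      (∀ i, 0 < ns i) → (∀ i, Ai i ∈ K (ns i)) →
      (∀ i, Function.Surjective (γ i).mulVec) →
      (∑ i, (γ i)ᴴ * γ i) = 1 →
      (∑ i, mconj (γ i) (Ai i)) = A →
      ∀ i, ∃ (h : ns i = n) (U : Matrix (Fin n) (Fin n) ℂ),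
        U ∈ Matrix.unitaryGroup (Fin n) ℂ ∧
        Matrix.reindex (finCongr h) (finCongr h) (Ai i) = mconj U A

/-- `Γ_n(K)`. -/
def GammaSet (K : ∀ n : ℕ, Set (Matrix (Fin n) (Fin n) V)) (n : ℕ) :
    Set (Matrix (Fin n) (Fin n) ℂ × Matrix (Fin n) (Fin n) V) :=
  {P | ∃ (k : ℕ), 0 < k ∧ ∃ (A : Matrix (Fin k) (Fin k) V) (γ : Matrix (Fin k) (Fin n) ℂ),
    A ∈ K k ∧ (γᴴ * γ).trace = 1 ∧ P = (γᴴ * γ, mconj γ A)}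

/-- Matrix face `F ⊆ K_n`. -/
def IsMatrixFace (K : ∀ n : ℕ, Set (Matrix (Fin n) (Fin n) V)) {n : ℕ}
    (F : Set (Matrix (Fin n) (Fin n) V)) : Prop :=
  F ⊆ K n ∧ Convex ℝ F ∧
  ∀ (k : ℕ), 0 < k →
    ∀ (ns : Fin k → ℕ) (Ai : ∀ i : Fin k, Matrix (Fin (ns i)) (Fin (ns i)) V)
      (γ : ∀ i : Fin k, Matrix (Fin (ns i)) (Fin n) ℂ),
      (∀ i, 0 < ns i) → (∀ i, Ai i ∈ K (ns i)) →
      (∀ i, Function.Surjective (γ i).mulVec) →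
      (∑ i, (γ i)ᴴ * γ i) = 1 →
      (∑ i, mconj (γ i) (Ai i)) ∈ F →
      ∀ i, ∃ h : ns i = n, Matrix.reindex (finCongr h) (finCongr h) (Ai i) ∈ F

/-- `A` is a `C*`-extreme point of `F ⊆ M_n(V)`. -/
def IsCStarExtreme {n : ℕ} (F : Set (Matrix (Fin n) (Fin n) V))
    (A : Matrix (Fin n) (Fin n) V) : Prop :=
  A ∈ F ∧
  ∀ (k : ℕ), 0 < k →
    ∀ (Ai : Fin k → Matrix (Fin n) (Fin n) V) (γ : Fin k → Matrix (Fin n) (Fin n) ℂ),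
      (∀ i, Ai i ∈ F) → (∀ i, IsUnit (γ i)) →
      (∑ i, (γ i)ᴴ * γ i) = 1 →
      (∑ i, mconj (γ i) (Ai i)) = A →
      ∀ i, ∃ U ∈ Matrix.unitaryGroup (Fin n) ℂ, Ai i = mconj U A

section Top2

variable [TopologicalSpace V]

/-- `(Φ, α)` is an exposing pair for the face `F ⊆ K_n`. -/
def IsFaceExposingPair (K : ∀ n : ℕ, Set (Matrix (Fin n) (Fin n) V)) {n : ℕ}
    (F : Set (Matrix (Fin n) (Fin n) V))
    (Φ : V →L[ℂ] Matrix (Fin n) (Fin n) ℂ) (α : Matrix (Fin n) (Fin n) ℂ) : Prop :=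
  α.IsHermitian ∧
  (∀ m : ℕ, 0 < m → ∀ B ∈ K m,
    (α ⊗ₖ (1 : Matrix (Fin m) (Fin m) ℂ) - reM (amplify (⇑Φ) B)).PosSemidef) ∧
  (∀ m : ℕ, 0 < m → m < n → ∀ B ∈ K m,
    (α ⊗ₖ (1 : Matrix (Fin m) (Fin m) ℂ) - reM (amplify (⇑Φ) B)).PosDef) ∧
  {B | B ∈ K n ∧
      (α ⊗ₖ (1 : Matrix (Fin n) (Fin n) ℂ) - reM (amplify (⇑Φ) B)).PosSemidef ∧
      ¬ IsUnit (α ⊗ₖ (1 : Matrix (Fin n) (Fin n) ℂ) - reM (amplify (⇑Φ) B))} = F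

/-- `F ⊆ K_n` is a matrix exposed face of `K`. -/
def IsMatrixExposedFace (K : ∀ n : ℕ, Set (Matrix (Fin n) (Fin n) V)) {n : ℕ}
    (F : Set (Matrix (Fin n) (Fin n) V)) : Prop :=
  F ⊆ K n ∧ Convex ℝ F ∧
  ∃ (Φ : V →L[ℂ] Matrix (Fin n) (Fin n) ℂ) (α : Matrix (Fin n) (Fin n) ℂ),
    IsFaceExposingPair K F Φ α

/-- The unitary orbit of `F ⊆ M_n(V)`. -/
def unitaryOrbit {n : ℕ} (F : Set (Matrix (Fin n) (Fin n) V)) :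
    Set (Matrix (Fin n) (Fin n) V) :=
  {B | ∃ A ∈ F, ∃ U ∈ Matrix.unitaryGroup (Fin n) ℂ, B = mconj U A}

/-- `F ⊆ K_n` is a weak matrix exposed face of `K`. -/
def IsWeakMatrixExposedFace (K : ∀ n : ℕ, Set (Matrix (Fin n) (Fin n) V)) {n : ℕ}
    (F : Set (Matrix (Fin n) (Fin n) V)) : Prop :=
  F ⊆ K n ∧ Convex ℝ F ∧
  ∃ (Φ : V →L[ℂ] Matrix (Fin n) (Fin n) ℂ) (α : Matrix (Fin n) (Fin n) ℂ),
    α.IsHermitian ∧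
    (∀ m : ℕ, 0 < m → ∀ B ∈ K m,
      (α ⊗ₖ (1 : Matrix (Fin m) (Fin m) ℂ) - reM (amplify (⇑Φ) B)).PosSemidef) ∧
    (∀ m : ℕ, 0 < m → m < n → ∀ B ∈ K m,
      (α ⊗ₖ (1 : Matrix (Fin m) (Fin m) ℂ) - reM (amplify (⇑Φ) B)).PosDef) ∧
    {B | B ∈ K n ∧
        (α ⊗ₖ (1 : Matrix (Fin n) (Fin n) ℂ) - reM (amplify (⇑Φ) B)).PosSemidef ∧
        ¬ IsUnit (α ⊗ₖ (1 : Matrix (Fin n) (Fin n) ℂ) - reM (amplify (⇑Φ) B))} =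
      unitaryOrbit F

end Top2

/-- `F = (F_n)` is a matrix multiface of `K`. -/
def IsMatrixMultiface (K F : ∀ n : ℕ, Set (Matrix (Fin n) (Fin n) V)) : Prop :=
  (∀ n, F n ⊆ K n) ∧ (∀ n, Convex ℝ (F n)) ∧
  ∀ (k n : ℕ), 0 < k → 0 < n →
    ∀ (ns : Fin k → ℕ) (Ai : ∀ i : Fin k, Matrix (Fin (ns i)) (Fin (ns i)) V)
      (γ : ∀ i : Fin k, Matrix (Fin (ns i)) (Fin n) ℂ),
      (∀ i, 0 < ns i) → (∀ i, Ai i ∈ K (ns i)) →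
      (∀ i, Function.Surjective (γ i).mulVec) →
      (∑ i, (γ i)ᴴ * γ i) = 1 →
      (∑ i, mconj (γ i) (Ai i)) ∈ F n →
      ∀ i, Ai i ∈ F (ns i)

section Top3

variable [TopologicalSpace V]

/-- `F = (F_n)` is a matrix exposed multiface of `K`. -/
def IsMatrixExposedMultiface (K F : ∀ n : ℕ, Set (Matrix (Fin n) (Fin n) V)) : Prop :=
  (∀ n, F n ⊆ K n) ∧ (∀ n, Convex ℝ (F n)) ∧
  ∃ (r : ℕ), 0 < r ∧
    ∃ (Φ : V →L[ℂ] Matrix (Fin r) (Fin r) ℂ) (α : Matrix (Fin r) (Fin r) ℂ),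
      α.IsHermitian ∧
      (∀ n : ℕ, 0 < n → ∀ B ∈ K n,
        (α ⊗ₖ (1 : Matrix (Fin n) (Fin n) ℂ) - reM (amplify (⇑Φ) B)).PosSemidef) ∧
      (∀ n : ℕ, 0 < n →
        {B | B ∈ K n ∧
            (α ⊗ₖ (1 : Matrix (Fin n) (Fin n) ℂ) - reM (amplify (⇑Φ) B)).PosSemidef ∧
            ¬ IsUnit (α ⊗ₖ (1 : Matrix (Fin n) (Fin n) ℂ) - reM (amplify (⇑Φ) B))} = F n)

end Top3

end

section Statements

variable {E F' : Type*} [AddCommGroup E] [Module ℂ E] [AddCommGroup F'] [Module ℂ F']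

theorem Summable.hasSum_clm_apply {F G : Type*} [NormedAddCommGroup F] [NormedSpace ℝ F]
    [NormedAddCommGroup G] [NormedSpace ℝ G] {g : ℕ → F →L[ℝ] G} (hs : Summable g) (x : F) :
    HasSum (fun k => g k x) ((∑' k, g k) x) := by
  have := (ContinuousLinearMap.apply ℝ G x).hasSum hs.hasSum
  exact this

theorem summable_smulRight {F G : Type*} [NormedAddCommGroup F]
    [NormedSpace ℝ F] [NormedAddCommGroup G] [NormedSpace ℝ G] [CompleteSpace G]
    (f : ℕ → F →L[ℝ] ℝ) (g : ℕ → G) {u : ℕ → ℝ} (hu : Summable u)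
    (h : ∀ k, ‖f k‖ * ‖g k‖ ≤ u k) : Summable fun k => (f k).smulRight (g k) := by
  refine Summable.of_norm_bounded hu fun k => ?_
  rw [ContinuousLinearMap.norm_smulRight_apply]
  exact h k

/-- On a separable subset of a normed space there is a continuous symmetric bilinear form which is
strictly positive on the nonzero vectors of the subset. -/
theorem exists_bilin_pos_of_isSeparable {F : Type*} [NormedAddCommGroup F] [NormedSpace ℝ F]
    {D : Set F} (hD : TopologicalSpace.IsSeparable D) :
    ∃ b : F →L[ℝ] F →L[ℝ] ℝ, (∀ x y, b x y = b y x) ∧ ∀ x ∈ D, x ≠ 0 → 0 < b x x := by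
  obtain ⟨c, hc, hDc⟩ := hD
  rcases c.eq_empty_or_nonempty with rfl | hne
  · refine ⟨0, by simp, fun x hx => ?_⟩
    simp at hDc
    simp [hDc] at hx
  obtain ⟨d, rfl⟩ := hc.exists_eq_range hne
  choose f hf1 hfd using fun k => exists_dual_vector'' ℝ (d k)
  have hu : ∀ k, ‖f k‖ * ‖(1 / 2 : ℝ) ^ k • f k‖ ≤ (1 / 2 : ℝ) ^ k := fun k => by
    rw [norm_smul, Real.norm_of_nonneg (by positivity)]
    have h1 : (0 : ℝ) ≤ (1 / 2) ^ k := by positivity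
    nlinarith [mul_le_one₀ (hf1 k) (norm_nonneg _) (hf1 k)]
  have hs := summable_smulRight f _ summable_geometric_two hu
  obtain ⟨b, hb⟩ : ∃ b : F →L[ℝ] F →L[ℝ] ℝ,
      ∀ x, HasSum (fun k => f k x • (1 / 2 : ℝ) ^ k • f k) (b x) :=
    ⟨_, fun x => hs.hasSum_clm_apply x⟩
  have hgs : ∀ x y, HasSum (fun k => (1 / 2 : ℝ) ^ k * (f k x * f k y)) (b x y) := by
    intro x y
    have h1 := (hb x).summable.hasSum_clm_apply y
    rw [(hb x).tsum_eq] at h1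
    refine h1.congr_fun fun k => ?_
    simp only [smul_apply, smul_eq_mul]
    ring
  refine ⟨b, fun x y => ?_, fun x hx hx0 => ?_⟩
  · refine (hgs x y).unique ?_
    simpa only [mul_comm (f _ y)] using hgs y x
  · obtain ⟨_, ⟨k, rfl⟩, hk⟩ := Metric.mem_closure_iff.1 (hDc hx) (‖x‖ / 2)
      (by have := norm_pos_iff.2 hx0; positivity)
    have hfk : f k x ≠ 0 := by
      intro h0
      have h1 : ‖d k‖ ≤ ‖d k - x‖ := by
        have h2 : f k (d k - x) = ‖d k‖ := by rw [map_sub, h0, hfd]; simp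
        calc ‖d k‖ = ‖f k (d k - x)‖ := by rw [h2, norm_norm]
          _ ≤ 1 * ‖d k - x‖ := (f k).le_of_opNorm_le (hf1 k) _
          _ = _ := one_mul _
      have h3 : ‖x‖ ≤ ‖d k‖ + ‖d k - x‖ := by
        have := norm_sub_le (d k) (d k - x)
        simpa using this
      rw [dist_comm, dist_eq_norm] at hk
      linarith
    have hpos : 0 < (1 / 2 : ℝ) ^ k * (f k x * f k x) :=
      mul_pos (by positivity) (mul_self_pos.2 hfk)
    exact hpos.trans_le (le_hasSum (hgs x x) k fun j _ =>
      mul_nonneg (by positivity) (mul_self_nonneg _))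

/-- **Straszewicz–Klee**: a compact set in a locally convex space which embeds continuously in a
normed space lies in the closed convex hull of its exposed points. -/
theorem IsCompact.subset_closure_convexHull_exposedPoints {E F : Type*} [AddCommGroup E]
    [Module ℝ E] [TopologicalSpace E] [IsTopologicalAddGroup E] [ContinuousSMul ℝ E]
    [LocallyConvexSpace ℝ E] [NormedAddCommGroup F] [NormedSpace ℝ F] (T : E →L[ℝ] F)
    (hT : Function.Injective T) {C : Set E} (hC : IsCompact C) :
    C ⊆ closure (convexHull ℝ (C.exposedPoints ℝ)) := by
  intro x hx
  by_contra hxD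
  obtain ⟨u, s, hus, hsx⟩ := geometric_hahn_banach_closed_point (convex_convexHull ℝ _).closure
    isClosed_closure hxD
  have hsep : TopologicalSpace.IsSeparable ((fun p : E × E => T (p.1 - p.2)) '' C ×ˢ C) :=
    ((hC.prod hC).image (by fun_prop)).isSeparable
  obtain ⟨b, hbs, hbpos⟩ := exists_bilin_pos_of_isSeparable hsep
  have hq : Continuous fun z => b (T z) (T z) := by fun_prop
  obtain ⟨M, hM⟩ := (hC.image hq).isBounded.subset_closedBall 0
  have hM' : ∀ z ∈ C, |b (T z) (T z)| ≤ M := fun z hz => by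
    simpa using hM ⟨z, hz, rfl⟩
  have hM0 : 0 ≤ M := (abs_nonneg _).trans (hM' x hx)
  set lam : ℝ := (2 * M + 1) / (u x - s) with hlam
  have hlam0 : 0 < lam := div_pos (by linarith) (by linarith)
  have hlamM : lam * (u x - s) = 2 * M + 1 := by
    rw [hlam, div_mul_cancel₀]; linarith
  obtain ⟨y, hy, hmax⟩ := hC.exists_isMaxOn ⟨x, hx⟩
    (f := fun z => b (T z) (T z) + lam * u z) (by fun_prop)
  have hmax' : ∀ z ∈ C, b (T z) (T z) + lam * u z ≤ b (T y) (T y) + lam * u y := hmax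
  let h : E →L[ℝ] ℝ := (2 : ℝ) • (b (T y)).comp T + lam • u
  have hkey : ∀ z ∈ C, h z + b (T (z - y)) (T (z - y)) ≤ h y := by
    intro z hz
    have := hmax' z hz
    simp only [h, map_sub, add_apply, smul_apply,
      ContinuousLinearMap.comp_apply, sub_apply, smul_eq_mul, hbs (T z) (T y)]
    linarith
  have hyexp : y ∈ C.exposedPoints ℝ := by
    refine ⟨hy, h, fun z hz => ?_⟩
    by_cases hzy : z = y
    · simp [hzy]
    · have hpos := hbpos (T (z - y)) ⟨(z, y), ⟨hz, hy⟩, rfl⟩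
        (by rw [Ne, map_eq_zero_iff T hT, sub_eq_zero]; exact hzy)
      have := hkey z hz
      exact ⟨by linarith, fun h' => by linarith⟩
  have h1 := hus y (subset_closure (subset_convexHull ℝ _ hyexp))
  have h2 := hmax' x hx
  have h3 := abs_le.1 (hM' x hx)
  have h4 := abs_le.1 (hM' y hy)
  nlinarith

section MconjAlgebra

variable {V : Type*} [AddCommGroup V] [Module ℂ V] {k m n : ℕ}

theorem mconj_apply (γ : Matrix (Fin m) (Fin n) ℂ) (A : Matrix (Fin m) (Fin m) V) (i j : Fin n) :
    mconj γ A i j = ∑ k, ∑ l, (star (γ k i) * γ l j) • A k l := rfl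

theorem mconj_mconj (δ : Matrix (Fin m) (Fin n) ℂ) (γ : Matrix (Fin k) (Fin m) ℂ)
    (A : Matrix (Fin k) (Fin k) V) : mconj δ (mconj γ A) = mconj (γ * δ) A := by
  ext i j
  simp only [mconj_apply, Matrix.mul_apply, star_sum, Finset.sum_mul_sum, Finset.sum_smul,
    Finset.smul_sum, smul_smul]
  have h : ∀ f : Fin m → Fin m → Fin k → Fin k → V,
      ∑ p, ∑ q, ∑ a, ∑ b, f p q a b = ∑ a, ∑ b, ∑ p, ∑ q, f p q a b := by
    intro f
    rw [Finset.sum_congr rfl fun p _ => Finset.sum_comm, Finset.sum_comm]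
    refine Finset.sum_congr rfl fun a _ => ?_
    rw [Finset.sum_congr rfl fun p _ => Finset.sum_comm, Finset.sum_comm]
  rw [h]
  refine Finset.sum_congr rfl fun a _ => Finset.sum_congr rfl fun b _ =>
    Finset.sum_congr rfl fun p _ => Finset.sum_congr rfl fun q _ => ?_
  congr 1
  simp only [star_mul']
  ring

theorem mconj_one (A : Matrix (Fin n) (Fin n) V) : mconj 1 A = A := by
  ext i j
  simp [mconj_apply, Matrix.one_apply]

theorem mconj_zero_left (A : Matrix (Fin m) (Fin m) V) :
    mconj (0 : Matrix (Fin m) (Fin n) ℂ) A = 0 := by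
  ext i j
  simp [mconj_apply]

theorem mconj_smul_left (c : ℂ) (γ : Matrix (Fin m) (Fin n) ℂ) (A : Matrix (Fin m) (Fin m) V) :
    mconj (c • γ) A = (star c * c) • mconj γ A := by
  ext i j
  simp only [mconj_apply, Matrix.smul_apply, Finset.smul_sum, smul_smul, smul_eq_mul, star_mul']
  refine Finset.sum_congr rfl fun a _ => Finset.sum_congr rfl fun b _ => ?_
  congr 1
  ring

theorem mconj_add (γ : Matrix (Fin m) (Fin n) ℂ) (A B : Matrix (Fin m) (Fin m) V) :
    mconj γ (A + B) = mconj γ A + mconj γ B := by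
  ext i j
  simp [mconj_apply, Finset.sum_add_distrib]

theorem mconj_smul {R : Type*} [Monoid R] [DistribMulAction R V] [SMulCommClass ℂ R V] (c : R)
    (γ : Matrix (Fin m) (Fin n) ℂ) (A : Matrix (Fin m) (Fin m) V) :
    mconj γ (c • A) = c • mconj γ A := by
  ext i j
  simp only [mconj_apply, Matrix.smul_apply, Finset.smul_sum, smul_comm _ c]

theorem mconj_zero (γ : Matrix (Fin m) (Fin n) ℂ) :
    mconj γ (0 : Matrix (Fin m) (Fin m) V) = 0 := by
  ext i j
  simp [mconj_apply]

theorem mconj_sum {ι : Type*} (s : Finset ι) (γ : Matrix (Fin m) (Fin n) ℂ)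
    (A : ι → Matrix (Fin m) (Fin m) V) :
    mconj γ (∑ i ∈ s, A i) = ∑ i ∈ s, mconj γ (A i) := by
  classical
  induction s using Finset.induction_on with
  | empty => simp [mconj_zero]
  | insert a s ha ih => rw [Finset.sum_insert ha, Finset.sum_insert ha, mconj_add, ih]

theorem mconj_complex (γ : Matrix (Fin m) (Fin n) ℂ) (X : Matrix (Fin m) (Fin m) ℂ) :
    mconj γ X = γᴴ * X * γ := by
  ext i j
  simp only [mconj_apply, Matrix.mul_apply, Matrix.conjTranspose_apply, Finset.sum_mul,
    smul_eq_mul]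
  rw [Finset.sum_comm]
  refine Finset.sum_congr rfl fun a _ => Finset.sum_congr rfl fun b _ => ?_
  ring

end MconjAlgebra

section MconjTopology

variable {V : Type*} [NormedAddCommGroup V] [NormedSpace ℂ V] {m n : ℕ}

theorem continuous_mconj : Continuous fun p : Matrix (Fin m) (Fin n) ℂ × Matrix (Fin m) (Fin m) V =>
    mconj p.1 p.2 := by
  refine continuous_matrix fun i j => ?_
  simp only [mconj_apply]
  fun_prop

theorem continuous_mconj_right (γ : Matrix (Fin m) (Fin n) ℂ) :
    Continuous fun A : Matrix (Fin m) (Fin m) V => mconj γ A := by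
  refine continuous_matrix fun i j => ?_
  simp only [mconj_apply]
  fun_prop

/-- `A ↦ γ* A γ` as a continuous real-linear map. -/
noncomputable def mconjCLM (γ : Matrix (Fin m) (Fin n) ℂ) :
    Matrix (Fin m) (Fin m) V →L[ℝ] Matrix (Fin n) (Fin n) V where
  toFun := mconj γ
  map_add' := mconj_add γ
  map_smul' c A := mconj_smul c γ A
  cont := continuous_mconj_right γ

/-- The matrix unit embedding as a continuous real-linear map. -/
noncomputable def singleCLM (i j : Fin n) : V →L[ℝ] Matrix (Fin n) (Fin n) V where
  toFun v := Matrix.single i j v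
  map_add' := Matrix.single_add i j
  map_smul' c v := by simp [Matrix.smul_single]
  cont := by
    refine continuous_matrix fun a b => ?_
    simp only [Matrix.single_apply]
    split_ifs <;> fun_prop

/-- The real part of the trace as a continuous real-linear functional. -/
noncomputable def reTraceCLM (n : ℕ) : Matrix (Fin n) (Fin n) ℂ →L[ℝ] ℝ where
  toFun X := X.trace.re
  map_add' X Y := by simp
  map_smul' c X := by simp [Matrix.trace_smul]
  cont := by fun_prop

end MconjTopology

section Representation

variable {V : Type*} [NormedAddCommGroup V] [NormedSpace ℂ V] {m : ℕ}

/-- Real-linear functionals on `M_m(V)` correspond to linear maps `V → M_m(ℂ)`. -/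
theorem exists_amplify_eq (l : Matrix (Fin m) (Fin m) V →L[ℝ] ℝ) :
    ∃ Φ : V →L[ℂ] Matrix (Fin m) (Fin m) ℂ,
      ∀ (r : ℕ) (C : Matrix (Fin r) (Fin r) V) (ξ : Fin m × Fin r → ℂ),
        (star ξ ⬝ᵥ amplify Φ C *ᵥ ξ).re = l (mconj (Matrix.of fun j i => ξ (i, j)) C) := by
  let g : Fin m → Fin m → V →L[ℂ] ℂ := fun i j =>
    StrongDual.extendRCLike (𝕜 := ℂ) (l.comp (singleCLM i j))
  have hg : ∀ i j v, (g i j v).re = l (Matrix.single i j v) := fun i j v =>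
    StrongDual.re_extendRCLike_apply (𝕜 := ℂ) (l.comp (singleCLM i j)) v
  let Φ : V →L[ℂ] Matrix (Fin m) (Fin m) ℂ :=
    { toFun := fun v => Matrix.of fun i j => g i j v
      map_add' := fun v w => by ext i j; simp
      map_smul' := fun c v => by ext i j; simp
      cont := continuous_matrix fun i j => (g i j).continuous }
  refine ⟨Φ, fun r C ξ => ?_⟩
  have hl : ∀ Y : Matrix (Fin m) (Fin m) V, l Y = (∑ i, ∑ j, g i j (Y i j)).re := by
    intro Y
    conv_lhs => rw [Matrix.matrix_eq_sum_single Y]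
    simp only [map_sum, Complex.re_sum, hg]
  rw [hl]
  congr 1
  simp only [dotProduct, Matrix.mulVec, amplify, Fintype.sum_prod_type, mconj_apply, map_sum,
    map_smul, Φ, ContinuousLinearMap.coe_mk', LinearMap.coe_mk, AddHom.coe_mk, Matrix.of_apply,
    Pi.star_apply, Finset.mul_sum, smul_eq_mul]
  refine Finset.sum_congr rfl fun i _ => ?_
  rw [Finset.sum_comm]
  refine Finset.sum_congr rfl fun j _ => Finset.sum_congr rfl fun a _ =>
    Finset.sum_congr rfl fun b _ => ?_
  ring

end Representation

theorem reM_isHermitian {ι : Type*} (X : Matrix ι ι ℂ) : (reM X).IsHermitian := by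
  ext i j
  simp [reM, mul_add, add_comm]

theorem re_dotProduct_reM_mulVec {ι : Type*} [Fintype ι] (X : Matrix ι ι ℂ) (ξ : ι → ℂ) :
    (star ξ ⬝ᵥ reM X *ᵥ ξ).re = (star ξ ⬝ᵥ X *ᵥ ξ).re := by
  have h : star ξ ⬝ᵥ Xᴴ *ᵥ ξ = star (star ξ ⬝ᵥ X *ᵥ ξ) := by
    rw [Matrix.star_dotProduct, Matrix.star_mulVec, Matrix.conjTranspose_conjTranspose,
      Matrix.dotProduct_mulVec]
  rw [reM, Matrix.smul_mulVec, dotProduct_smul, Matrix.add_mulVec, dotProduct_add, h]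
  simp
  ring

section Reduction

theorem exists_isometry_mul_surjective {k n : ℕ} (γ : Matrix (Fin k) (Fin n) ℂ) :
    ∃ m ≤ n, ∃ (v : Matrix (Fin k) (Fin m) ℂ) (δ : Matrix (Fin m) (Fin n) ℂ)
      (ρ : Matrix (Fin n) (Fin m) ℂ), vᴴ * v = 1 ∧ v * δ = γ ∧ δ * ρ = 1 := by
  let f := Matrix.toEuclideanLin γ
  let b := stdOrthonormalBasis ℂ (LinearMap.range f)
  have hm : Module.finrank ℂ (LinearMap.range f) ≤ n := by
    simpa using LinearMap.finrank_range_le f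
  choose x hx using fun i => (b i).2
  let v : Matrix (Fin k) (Fin (Module.finrank ℂ (LinearMap.range f))) ℂ :=
    Matrix.of fun a i => (b i : EuclideanSpace ℂ (Fin k)) a
  let ρ : Matrix (Fin n) (Fin (Module.finrank ℂ (LinearMap.range f))) ℂ :=
    Matrix.of fun a i => x i a
  have hv : vᴴ * v = 1 := by
    ext i j
    have := orthonormal_iff_ite.1 b.orthonormal i j
    rw [Submodule.coe_inner, PiLp.inner_apply] at this
    rw [Matrix.one_apply, ← this]
    simp [Matrix.mul_apply, v, mul_comm]
  have hρ : γ * ρ = v := by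
    ext a i
    have := congrArg (fun y : EuclideanSpace ℂ (Fin k) => y a) (hx i)
    simpa [f, Matrix.mul_apply, ρ, v, Matrix.toLpLin_apply, Matrix.mulVec, dotProduct] using this
  refine ⟨_, hm, v, vᴴ * γ, ρ, hv, ?_, ?_⟩
  · ext a j
    let y : LinearMap.range f := ⟨f (EuclideanSpace.single j 1), ⟨_, rfl⟩⟩
    have hy : ∀ c, (y : EuclideanSpace ℂ (Fin k)) c = γ c j := by
      intro c
      simp [y, f, Matrix.toLpLin_apply]
    have := congrArg (fun z : LinearMap.range f => (z : EuclideanSpace ℂ (Fin k)) a) (b.sum_repr' y)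
    simp only [Submodule.coe_sum, Submodule.coe_smul, Submodule.coe_inner, PiLp.inner_apply,
      hy, WithLp.ofLp_sum, WithLp.ofLp_smul, Finset.sum_apply, Pi.smul_apply, smul_eq_mul] at this
    rw [← this, Matrix.mul_apply]
    refine Finset.sum_congr rfl fun i _ => ?_
    simp [Matrix.mul_apply, v, mul_comm]
  · rw [Matrix.mul_assoc, hρ, hv]

variable {V : Type*} [AddCommGroup V] [Module ℂ V] {K : ∀ n : ℕ, Set (Matrix (Fin n) (Fin n) V)}

theorem IsMatrixConvex.mconj_mem (hK : IsMatrixConvex K) {m n : ℕ} (hm : 0 < m) (hn : 0 < n)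
    {A : Matrix (Fin m) (Fin m) V} (hA : A ∈ K m) {γ : Matrix (Fin m) (Fin n) ℂ}
    (hγ : γᴴ * γ = 1) : mconj γ A ∈ K n := by
  simpa using hK 1 n one_pos hn (fun _ => m) (fun _ => A) (fun _ => γ) (fun _ => hm)
    (fun _ => hA) (by simpa using hγ)

theorem IsMatrixConvex.exists_square_of_le (hK : IsMatrixConvex K) {m n : ℕ} (hm : 0 < m)
    (hmn : m ≤ n) {A : Matrix (Fin m) (Fin m) V} (hA : A ∈ K m) (δ : Matrix (Fin m) (Fin n) ℂ) :
    ∃ B ∈ K n, ∃ η : Matrix (Fin n) (Fin n) ℂ, ηᴴ * η = δᴴ * δ ∧ mconj η B = mconj δ A := by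
  let w : Matrix (Fin m) (Fin n) ℂ := (1 : Matrix (Fin n) (Fin n) ℂ).submatrix (Fin.castLE hmn) id
  have hw : w * wᴴ = 1 := by
    ext i j
    simp [w, Matrix.mul_apply, Matrix.one_apply, eq_comm]
  let q : Matrix (Fin n) (Fin n) ℂ := 1 - wᴴ * w
  have hqw : q * wᴴ = 0 := by
    simp only [q]
    rw [Matrix.sub_mul, Matrix.mul_assoc, hw, Matrix.mul_one, Matrix.one_mul, sub_self]
  have hqh : qᴴ = q := by simp [q]
  have hqq : q * q = q := by
    nth_rewrite 2 [show q = 1 - wᴴ * w from rfl]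
    rw [Matrix.mul_sub, ← Matrix.mul_assoc, hqw, Matrix.mul_one, Matrix.zero_mul, sub_zero]
  let u : Fin n → Matrix (Fin m) (Fin n) ℂ := fun j => Matrix.single (⟨0, hm⟩ : Fin m) j (1 : ℂ) * q
  have hu : ∑ j, (u j)ᴴ * u j = q := by
    have h1 : ∀ j, (u j)ᴴ * u j = q * Matrix.single j j (1 : ℂ) * q := by
      intro j
      simp only [u, Matrix.conjTranspose_mul, hqh, Matrix.conjTranspose_single, star_one]
      rw [Matrix.mul_assoc, ← Matrix.mul_assoc (Matrix.single _ _ _) (Matrix.single _ _ _),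
        Matrix.single_mul_single_same, mul_one, Matrix.mul_assoc]
    have hone : ∑ j : Fin n, Matrix.single j j (1 : ℂ) = 1 := by
      rw [Matrix.sum_single_one]
    rw [Finset.sum_congr rfl fun j _ => h1 j, ← Finset.sum_mul, ← Finset.mul_sum,
      hone, mul_one, hqq]
  let g : Fin (n + 1) → Matrix (Fin m) (Fin n) ℂ := Fin.cons w u
  have hmem : ∑ i, mconj (g i) A ∈ K n := by
    refine hK (n + 1) n n.succ_pos (hm.trans_le hmn) (fun _ => m) (fun _ => A) g (fun _ => hm)
      (fun _ => hA) ?_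
    rw [Fin.sum_univ_succ]
    simp only [g, Fin.cons_zero, Fin.cons_succ, hu]
    simp [q]
  refine ⟨_, hmem, wᴴ * δ, ?_, ?_⟩
  · rw [Matrix.conjTranspose_mul, Matrix.conjTranspose_conjTranspose, Matrix.mul_assoc,
      ← Matrix.mul_assoc w, hw, Matrix.one_mul]
  · rw [mconj_sum, Fin.sum_univ_succ]
    simp only [g, Fin.cons_zero, Fin.cons_succ, mconj_mconj]
    rw [← Matrix.mul_assoc, hw, Matrix.one_mul, Finset.sum_eq_zero, add_zero]
    intro j _
    simp only [u]
    rw [← Matrix.mul_assoc, Matrix.mul_assoc _ q, hqw, Matrix.mul_zero, Matrix.zero_mul,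
      mconj_zero_left]

/-- A nonzero compression factors through a surjective one. -/
theorem IsMatrixConvex.exists_surjective (hK : IsMatrixConvex K) {k n : ℕ} (hk : 0 < k)
    {A : Matrix (Fin k) (Fin k) V} (hA : A ∈ K k) {γ : Matrix (Fin k) (Fin n) ℂ} (hγ : γ ≠ 0) :
    ∃ m, 0 < m ∧ m ≤ n ∧ ∃ B ∈ K m, ∃ (δ : Matrix (Fin m) (Fin n) ℂ)
      (ρ : Matrix (Fin n) (Fin m) ℂ), δ * ρ = 1 ∧ δᴴ * δ = γᴴ * γ ∧ mconj δ B = mconj γ A := by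
  obtain ⟨m, hmn, v, δ, ρ, hv, rfl, hρ⟩ := exists_isometry_mul_surjective γ
  have hm : 0 < m := by
    rcases Nat.eq_zero_or_pos m with rfl | h
    · exact absurd (by ext i j; simp [Matrix.mul_apply]) hγ
    · exact h
  refine ⟨m, hm, hmn, mconj v A, hK.mconj_mem hk hm hA hv, δ, ρ, hρ, ?_, mconj_mconj _ _ _⟩
  rw [Matrix.conjTranspose_mul, Matrix.mul_assoc, ← Matrix.mul_assoc vᴴ, hv, Matrix.one_mul]

theorem IsMatrixConvex.exists_square (hK : IsMatrixConvex K) {k n : ℕ} (hk : 0 < k)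
    {A : Matrix (Fin k) (Fin k) V} (hA : A ∈ K k) {γ : Matrix (Fin k) (Fin n) ℂ} (hγ : γ ≠ 0) :
    ∃ B ∈ K n, ∃ η : Matrix (Fin n) (Fin n) ℂ, ηᴴ * η = γᴴ * γ ∧ mconj η B = mconj γ A := by
  obtain ⟨m, hm, hmn, B, hB, δ, -, -, h1, h2⟩ := hK.exists_surjective hk hA hγ
  obtain ⟨D, hD, η, h3, h4⟩ := hK.exists_square_of_le hm hmn hB δ
  exact ⟨D, hD, η, h3.trans h1, h4.trans h2⟩

end Reduction

theorem exists_trace_conjTranspose_mul_self {m n : ℕ} {γ : Matrix (Fin m) (Fin n) ℂ} (hγ : γ ≠ 0) :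
    ∃ t : ℝ, 0 < t ∧ (γᴴ * γ).trace = t := by
  have h0 : (γᴴ * γ).trace ≠ 0 := fun h =>
    hγ (Matrix.trace_conjTranspose_mul_self_eq_zero_iff.1 h)
  have h1 := (Matrix.posSemidef_conjTranspose_mul_self γ).trace_nonneg
  obtain ⟨h2, h3⟩ := Complex.nonneg_iff.1 h1
  have h4 : (γᴴ * γ).trace = ((γᴴ * γ).trace.re : ℂ) := Complex.ext rfl (by simpa using h3.symm)
  exact ⟨_, lt_of_le_of_ne h2 fun h => h0 (by rw [h4, ← h, Complex.ofReal_zero]), h4⟩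

section Exposed

theorem amplify_one {m r : ℕ} (Φ : ℂ →L[ℂ] Matrix (Fin m) (Fin m) ℂ) :
    amplify (⇑Φ) (1 : Matrix (Fin r) (Fin r) ℂ) = Φ 1 ⊗ₖ (1 : Matrix (Fin r) (Fin r) ℂ) := by
  ext p q
  by_cases h : p.2 = q.2 <;> simp [amplify, Matrix.one_apply, h]

theorem reM_sub {ι : Type*} (X Y : Matrix ι ι ℂ) : reM (X - Y) = reM X - reM Y := by
  simp only [reM, Matrix.conjTranspose_sub, ← smul_sub]
  congr 1
  abel

theorem reM_kronecker_one {m r : ℕ} (X : Matrix (Fin m) (Fin m) ℂ) :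
    reM (X ⊗ₖ (1 : Matrix (Fin r) (Fin r) ℂ)) = reM X ⊗ₖ (1 : Matrix (Fin r) (Fin r) ℂ) := by
  rw [reM, Matrix.conjTranspose_kronecker, Matrix.conjTranspose_one, ← Matrix.add_kronecker,
    ← Matrix.smul_kronecker, reM]

theorem posSemidef_reM_iff {ι : Type*} [Fintype ι] (X : Matrix ι ι ℂ) :
    (reM X).PosSemidef ↔ ∀ ξ : ι → ℂ, 0 ≤ (star ξ ⬝ᵥ X *ᵥ ξ).re := by
  rw [Matrix.posSemidef_iff_dotProduct_mulVec]
  simp only [reM_isHermitian, true_and]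
  refine forall_congr' fun ξ => ?_
  rw [← re_dotProduct_reM_mulVec, Complex.nonneg_iff]
  exact and_iff_left (by
    have := (reM_isHermitian X).im_star_dotProduct_mulVec_self ξ
    simpa using this.symm)

theorem not_isUnit_reM_iff {ι : Type*} [Fintype ι] [DecidableEq ι] {X : Matrix ι ι ℂ}
    (hX : (reM X).PosSemidef) :
    ¬ IsUnit (reM X) ↔ ∃ ξ : ι → ℂ, ξ ≠ 0 ∧ (star ξ ⬝ᵥ X *ᵥ ξ).re = 0 := by
  rw [Matrix.isUnit_iff_isUnit_det, isUnit_iff_ne_zero, not_not,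
    ← Matrix.exists_mulVec_eq_zero_iff]
  refine exists_congr fun ξ => and_congr_right fun _ => ?_
  rw [← hX.dotProduct_mulVec_zero_iff, ← re_dotProduct_reM_mulVec]
  refine ⟨fun h => by rw [h, Complex.zero_re], fun h => Complex.ext h ?_⟩
  have := (reM_isHermitian X).im_star_dotProduct_mulVec_self ξ
  simpa using this

variable {V : Type*} [NormedAddCommGroup V] [NormedSpace ℂ V]
  {K : ∀ n : ℕ, Set (Matrix (Fin n) (Fin n) V)} {m : ℕ}

/-- A real functional on `M_m(ℂ) × M_m(V)` nonnegative on all `(δ* δ, δ* C δ)` and vanishing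
precisely on the orbit of `A` yields an exposing pair. -/
theorem isMatrixExposed_of_functional {A : Matrix (Fin m) (Fin m) V}
    (L₁ : Matrix (Fin m) (Fin m) ℂ →L[ℝ] ℝ) (L₂ : Matrix (Fin m) (Fin m) V →L[ℝ] ℝ)
    (hpos : ∀ r, 0 < r → ∀ C ∈ K r, ∀ δ : Matrix (Fin r) (Fin m) ℂ,
      0 ≤ L₁ (δᴴ * δ) - L₂ (mconj δ C))
    (hm : 0 < m)
    (heq : ∀ C, (C ∈ K m ∧ ∃ δ : Matrix (Fin m) (Fin m) ℂ, δ ≠ 0 ∧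
      L₁ (δᴴ * δ) - L₂ (mconj δ C) = 0) ↔ ∃ U ∈ Matrix.unitaryGroup (Fin m) ℂ, C = mconj U A) :
    IsMatrixExposed K A := by
  obtain ⟨Φ, hΦ⟩ := exists_amplify_eq L₂
  obtain ⟨Ψ, hΨ⟩ := exists_amplify_eq L₁
  have hform : ∀ r (C : Matrix (Fin r) (Fin r) V) (ξ : Fin m × Fin r → ℂ),
      (star ξ ⬝ᵥ (Ψ 1 ⊗ₖ (1 : Matrix (Fin r) (Fin r) ℂ) - amplify (⇑Φ) C) *ᵥ ξ).re =
        L₁ ((Matrix.of fun j i => ξ (i, j))ᴴ * Matrix.of fun j i => ξ (i, j)) -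
          L₂ (mconj (Matrix.of fun j i => ξ (i, j)) C) := by
    intro r C ξ
    rw [Matrix.sub_mulVec, dotProduct_sub, Complex.sub_re, hΦ, ← amplify_one, hΨ, mconj_complex,
      Matrix.mul_one]
  have hre : ∀ r (C : Matrix (Fin r) (Fin r) V),
      reM (Ψ 1) ⊗ₖ (1 : Matrix (Fin r) (Fin r) ℂ) - reM (amplify (⇑Φ) C) =
        reM (Ψ 1 ⊗ₖ (1 : Matrix (Fin r) (Fin r) ℂ) - amplify (⇑Φ) C) := fun r C => by
    rw [reM_sub, reM_kronecker_one]
  have hpsd : ∀ r, 0 < r → ∀ C ∈ K r,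
      (reM (Ψ 1 ⊗ₖ (1 : Matrix (Fin r) (Fin r) ℂ) - amplify (⇑Φ) C)).PosSemidef := by
    intro r hr C hC
    refine (posSemidef_reM_iff _).2 fun ξ => ?_
    rw [hform]
    exact hpos r hr C hC _
  refine ⟨Φ, reM (Ψ 1), reM_isHermitian _, fun r hr C hC => ?_, ?_⟩
  · rw [hre]
    exact hpsd r hr C hC
  · ext C
    simp only [Set.mem_ofPred_eq, hre, ← heq]
    refine and_congr_right fun hC => ?_
    rw [and_iff_right (hpsd m hm C hC), not_isUnit_reM_iff (hpsd m hm C hC)]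
    simp only [hform]
    constructor
    · rintro ⟨ξ, hξ, h⟩
      refine ⟨_, fun h0 => hξ ?_, h⟩
      ext p
      exact congrFun (congrFun h0 p.2) p.1
    · rintro ⟨δ, hδ, h⟩
      refine ⟨fun p => δ p.2 p.1, fun h0 => hδ ?_, h⟩
      ext j i
      exact congrFun h0 (i, j)

end Exposed

section GammaImage

variable {V : Type*} [NormedAddCommGroup V] [NormedSpace ℂ V] {n : ℕ}

/-- The pairs `(γ* γ, γ* A γ)` with `A ∈ S` and `γ` a square matrix of Hilbert–Schmidt norm one. -/
def gammaImage (S : Set (Matrix (Fin n) (Fin n) V)) :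
    Set (Matrix (Fin n) (Fin n) ℂ × Matrix (Fin n) (Fin n) V) :=
  (fun p : Matrix (Fin n) (Fin n) ℂ × Matrix (Fin n) (Fin n) V => (p.1ᴴ * p.1, mconj p.1 p.2)) ''
    ({γ | (γᴴ * γ).trace = 1} ×ˢ S)

theorem isCompact_trace_conjTranspose_mul_self_eq_one :
    IsCompact {γ : Matrix (Fin n) (Fin n) ℂ | (γᴴ * γ).trace = 1} := by
  have h1 : IsCompact (Set.univ.pi fun _ : Fin n => Set.univ.pi fun _ : Fin n =>
      Metric.closedBall (0 : ℂ) 1) :=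
    isCompact_univ_pi fun _ => isCompact_univ_pi fun _ => isCompact_closedBall _ _
  have h2 : IsClosed {γ : Matrix (Fin n) (Fin n) ℂ | (γᴴ * γ).trace = 1} :=
    isClosed_eq (by fun_prop) continuous_const
  refine IsCompact.of_isClosed_subset h1 h2 fun γ hγ i _ j _ => ?_
  have h3 : ∑ b, ∑ a, ‖γ a b‖ ^ 2 = 1 := by
    have h4 : (γᴴ * γ).trace = ((∑ b, ∑ a, ‖γ a b‖ ^ 2 : ℝ) : ℂ) := by
      simp [Matrix.trace, Matrix.mul_apply, Complex.conj_mul']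
    rw [Set.mem_ofPred_eq] at hγ
    rw [hγ] at h4
    exact_mod_cast h4.symm
  have h5 : ‖γ i j‖ ^ 2 ≤ 1 := by
    rw [← h3]
    exact (Finset.single_le_sum (f := fun a => ‖γ a j‖ ^ 2) (fun a _ => sq_nonneg _)
      (Finset.mem_univ i)).trans
      (Finset.single_le_sum (f := fun b => ∑ a, ‖γ a b‖ ^ 2)
        (fun b _ => Finset.sum_nonneg fun a _ => sq_nonneg _) (Finset.mem_univ j))
  rw [mem_closedBall_zero_iff]
  exact (sq_le_one_iff₀ (norm_nonneg _)).1 h5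

theorem isCompact_gammaImage {S : Set (Matrix (Fin n) (Fin n) V)} (hS : IsCompact S) :
    IsCompact (gammaImage S) := by
  refine (isCompact_trace_conjTranspose_mul_self_eq_one.prod hS).image ?_
  have h1 : Continuous fun p : Matrix (Fin n) (Fin n) ℂ × Matrix (Fin n) (Fin n) V =>
      p.1ᴴ * p.1 := by fun_prop
  exact h1.prodMk continuous_mconj

theorem smul_conjTranspose_mul_smul_self {k : ℕ} (c : ℝ) (γ : Matrix (Fin k) (Fin n) ℂ) :
    ((c : ℂ) • γ)ᴴ * ((c : ℂ) • γ) = (c ^ 2) • (γᴴ * γ) := by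
  ext i j
  simp [Matrix.mul_apply, Finset.mul_sum]
  refine Finset.sum_congr rfl fun a _ => ?_
  ring

theorem mconj_ofReal_smul {k : ℕ} (c : ℝ) (γ : Matrix (Fin k) (Fin n) ℂ)
    (A : Matrix (Fin k) (Fin k) V) : mconj ((c : ℂ) • γ) A = (c ^ 2) • mconj γ A := by
  rw [mconj_smul_left]
  ext i j
  rw [Matrix.smul_apply, Matrix.smul_apply, ← Complex.coe_smul]
  congr 1
  simp
  ring

theorem inv_smul_mem_gammaImage {S : Set (Matrix (Fin n) (Fin n) V)} {A} (hA : A ∈ S)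
    {γ : Matrix (Fin n) (Fin n) ℂ} {t : ℝ} (ht : 0 < t) (h : (γᴴ * γ).trace = t) :
    (t⁻¹ • (γᴴ * γ), t⁻¹ • mconj γ A) ∈ gammaImage S := by
  have h1 : ((√t)⁻¹) ^ 2 = t⁻¹ := by rw [inv_pow, Real.sq_sqrt ht.le]
  refine ⟨((((√t)⁻¹ : ℝ) : ℂ) • γ, A), ⟨?_, hA⟩, ?_⟩
  · rw [Set.mem_ofPred_eq, smul_conjTranspose_mul_smul_self, h1, Matrix.trace_smul, h]
    simp [ht.ne']
  · simp only [smul_conjTranspose_mul_smul_self, mconj_ofReal_smul, h1]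

theorem inv_smul_mem_gammaImage_of_isMatrixConvex {K : ∀ n : ℕ, Set (Matrix (Fin n) (Fin n) V)}
    (hK : IsMatrixConvex K) {k : ℕ} (hk : 0 < k) {A} (hA : A ∈ K k)
    {γ : Matrix (Fin k) (Fin n) ℂ} {t : ℝ} (ht : 0 < t) (h : (γᴴ * γ).trace = t) :
    (t⁻¹ • (γᴴ * γ), t⁻¹ • mconj γ A) ∈ gammaImage (K n) := by
  have hγ : γ ≠ 0 := by
    rintro rfl
    exact ht.ne' (by simpa using h.symm)
  obtain ⟨B, hB, η, h1, h2⟩ := hK.exists_square hk hA hγ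
  rw [← h1, ← h2]
  exact inv_smul_mem_gammaImage hB ht (h1 ▸ h)

theorem exists_isMatrixExposed_of_mem_exposedPoints {K : ∀ n : ℕ, Set (Matrix (Fin n) (Fin n) V)}
    (hK : IsMatrixConvex K) (hn : 0 < n) {P : Matrix (Fin n) (Fin n) ℂ × Matrix (Fin n) (Fin n) V}
    (hP : P ∈ (gammaImage (K n)).exposedPoints ℝ) :
    ∃ m, 0 < m ∧ ∃ A ∈ K m, IsMatrixExposed K A ∧
      ∃ δ : Matrix (Fin m) (Fin n) ℂ, P = (δᴴ * δ, mconj δ A) := by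
  obtain ⟨⟨⟨γ, A'⟩, ⟨hγ, hA'⟩, rfl⟩, l, hl⟩ := hP
  have hγ0 : γ ≠ 0 := by
    rintro rfl
    simp at hγ
  obtain ⟨m, hm, -, A, hA, δ₀, ρ, hρ, h1, h2⟩ := hK.exists_surjective hn hA' hγ0
  have hP : (γᴴ * γ, mconj γ A') = (δ₀ᴴ * δ₀, mconj δ₀ A) := by rw [h1, h2]
  simp only [hP] at hl
  refine ⟨m, hm, A, hA, ?_, δ₀, hP⟩
  have htr0 : (δ₀ᴴ * δ₀).trace = 1 := h1 ▸ hγ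
  set c : ℝ := l (δ₀ᴴ * δ₀, mconj δ₀ A) with hc
  have hρ' : ρᴴ * δ₀ᴴ = 1 := by
    rw [← Matrix.conjTranspose_mul, hρ, Matrix.conjTranspose_one]
  have hne : ∀ {r : ℕ} {δ : Matrix (Fin r) (Fin m) ℂ}, δ ≠ 0 → δ * δ₀ ≠ 0 := by
    intro r δ hδ h
    apply hδ
    rw [← Matrix.mul_one δ, ← hρ, ← Matrix.mul_assoc, h, Matrix.zero_mul]
  let L₁ : Matrix (Fin m) (Fin m) ℂ →L[ℝ] ℝ :=
    (c • reTraceCLM n - l.comp (ContinuousLinearMap.inl ℝ _ _)).comp (mconjCLM δ₀)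
  let L₂ : Matrix (Fin m) (Fin m) V →L[ℝ] ℝ :=
    (l.comp (ContinuousLinearMap.inr ℝ _ _)).comp (mconjCLM δ₀)
  have hL : ∀ {r : ℕ} (C : Matrix (Fin r) (Fin r) V) (δ : Matrix (Fin r) (Fin m) ℂ),
      L₁ (δᴴ * δ) - L₂ (mconj δ C) =
        c * (((δ * δ₀)ᴴ * (δ * δ₀)).trace).re - l ((δ * δ₀)ᴴ * (δ * δ₀), mconj (δ * δ₀) C) := by
    intro r C δ
    have h3 : mconj δ₀ (δᴴ * δ) = (δ * δ₀)ᴴ * (δ * δ₀) := by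
      rw [mconj_complex, Matrix.conjTranspose_mul]
      simp only [Matrix.mul_assoc]
    have h4 : L₁ (δᴴ * δ) = c * ((mconj δ₀ (δᴴ * δ)).trace).re - l (mconj δ₀ (δᴴ * δ), 0) := rfl
    have h5 : L₂ (mconj δ C) = l (0, mconj δ₀ (mconj δ C)) := rfl
    rw [h4, h5, h3, mconj_mconj, sub_sub, ← map_add, Prod.mk_add_mk, add_zero, zero_add]
  have hscale : ∀ {r : ℕ} (C : Matrix (Fin r) (Fin r) V) (δ : Matrix (Fin r) (Fin m) ℂ) {t : ℝ},
      0 < t → ((δ * δ₀)ᴴ * (δ * δ₀)).trace = t →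
      L₁ (δᴴ * δ) - L₂ (mconj δ C) =
        t * (c - l (t⁻¹ • ((δ * δ₀)ᴴ * (δ * δ₀)), t⁻¹ • mconj (δ * δ₀) C)) := by
    intro r C δ t ht h
    rw [hL, h, ← Prod.smul_mk, map_smul, smul_eq_mul, Complex.ofReal_re]
    field_simp
  refine isMatrixExposed_of_functional L₁ L₂ ?_ hm ?_
  · intro r hr C hC δ
    by_cases hδ : δ = 0
    · subst hδ
      simp [mconj_zero_left]
    · obtain ⟨t, ht, h⟩ := exists_trace_conjTranspose_mul_self (hne hδ)
      rw [hscale C δ ht h]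
      exact mul_nonneg ht.le (sub_nonneg.2
        (hl _ (inv_smul_mem_gammaImage_of_isMatrixConvex hK hr hC ht h)).1)
  · intro C
    constructor
    · rintro ⟨hC, δ, hδ, h0⟩
      obtain ⟨t, ht, h⟩ := exists_trace_conjTranspose_mul_self (hne hδ)
      rw [hscale C δ ht h, mul_eq_zero, or_iff_right ht.ne', sub_eq_zero] at h0
      have h6 := (hl _ (inv_smul_mem_gammaImage_of_isMatrixConvex hK hm hC ht h)).2 h0.le
      obtain ⟨h7, h8⟩ := Prod.mk.inj h6
      have h9 : t⁻¹ • (δᴴ * δ) = 1 := by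
        calc t⁻¹ • (δᴴ * δ) = t⁻¹ • ((ρᴴ * δ₀ᴴ) * (δᴴ * δ) * (δ₀ * ρ)) := by
              rw [hρ, hρ', Matrix.mul_one, Matrix.one_mul]
          _ = ρᴴ * (t⁻¹ • ((δ * δ₀)ᴴ * (δ * δ₀))) * ρ := by
              rw [Matrix.mul_smul, Matrix.smul_mul, Matrix.conjTranspose_mul]
              simp only [Matrix.mul_assoc]
          _ = (ρᴴ * δ₀ᴴ) * (δ₀ * ρ) := by
              rw [h7]
              simp only [Matrix.mul_assoc]
          _ = 1 := by rw [hρ, hρ', Matrix.mul_one]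
      have h10 : t⁻¹ • mconj δ C = A := by
        calc t⁻¹ • mconj δ C = t⁻¹ • mconj (δ₀ * ρ) (mconj δ C) := by rw [hρ, mconj_one]
          _ = mconj ρ (t⁻¹ • mconj (δ * δ₀) C) := by
              rw [mconj_smul, mconj_mconj, mconj_mconj, Matrix.mul_assoc]
          _ = A := by rw [h8, mconj_mconj, hρ, mconj_one]
      have hs : ((√t)⁻¹) ^ 2 = t⁻¹ := by rw [inv_pow, Real.sq_sqrt ht.le]
      rw [← hs, ← smul_conjTranspose_mul_smul_self] at h9
      rw [← hs, ← mconj_ofReal_smul] at h10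
      have h11 := mul_eq_one_comm.1 h9
      refine ⟨((((√t)⁻¹ : ℝ) : ℂ) • δ)ᴴ, Matrix.mem_unitaryGroup_iff.2 ?_, ?_⟩
      · rw [Matrix.star_eq_conjTranspose, Matrix.conjTranspose_conjTranspose, h9]
      · rw [← h10, mconj_mconj, h11, mconj_one]
    · rintro ⟨U, hU, rfl⟩
      have hU1 : Uᴴ * U = 1 := Matrix.mem_unitaryGroup_iff'.1 hU
      have hU2 : U * Uᴴ = 1 := Matrix.mem_unitaryGroup_iff.1 hU
      refine ⟨hK.mconj_mem hm hm hA hU1, Uᴴ, ?_, ?_⟩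
      · intro h
        have : (1 : Matrix (Fin m) (Fin m) ℂ) ⟨0, hm⟩ ⟨0, hm⟩ = 0 := by
          rw [← hU2, h, Matrix.mul_zero, Matrix.zero_apply]
        simp at this
      · have h3 : (Uᴴ * δ₀)ᴴ * (Uᴴ * δ₀) = δ₀ᴴ * δ₀ := by
          rw [Matrix.conjTranspose_mul, Matrix.conjTranspose_conjTranspose, Matrix.mul_assoc,
            ← Matrix.mul_assoc U, hU2, Matrix.one_mul]
        rw [hL, h3, mconj_mconj, ← Matrix.mul_assoc, hU2, Matrix.one_mul, htr0]
        simp [hc]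

end GammaImage

section MatrixHull

theorem exists_conjTranspose_mul_self_eq {n : ℕ} {X : Matrix (Fin n) (Fin n) ℂ}
    (hX : X.PosSemidef) : ∃ R : Matrix (Fin n) (Fin n) ℂ, X = Rᴴ * R := by
  open scoped MatrixOrder in
  obtain ⟨Y, hY, -, h⟩ := CFC.exists_sqrt_of_isSelfAdjoint_of_quasispectrumRestricts
    hX.isHermitian (QuasispectrumRestricts.nnreal_of_nonneg hX.nonneg)
  exact ⟨Y, by rw [← h, ← Matrix.star_eq_conjTranspose, hY.star_eq]⟩

variable {V : Type*} [NormedAddCommGroup V] [NormedSpace ℂ V] {n : ℕ}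

/-- Matrix convex combinations of matrix exposed points. -/
def exposedHull (K : ∀ n : ℕ, Set (Matrix (Fin n) (Fin n) V)) (n : ℕ) :
    Set (Matrix (Fin n) (Fin n) V) :=
  {B : Matrix (Fin n) (Fin n) V |
    ∃ (k : ℕ), 0 < k ∧
    ∃ (ns : Fin k → ℕ) (Ai : ∀ i : Fin k, Matrix (Fin (ns i)) (Fin (ns i)) V)
      (γ : ∀ i : Fin k, Matrix (Fin (ns i)) (Fin n) ℂ),
      (∀ i, 0 < ns i) ∧ (∀ i, Ai i ∈ K (ns i) ∧ IsMatrixExposed K (Ai i)) ∧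
      (∑ i, (γ i)ᴴ * γ i) = 1 ∧ B = ∑ i, mconj (γ i) (Ai i)}

variable {K : ∀ n : ℕ, Set (Matrix (Fin n) (Fin n) V)}

theorem exposedHull_subset (hK : IsMatrixConvex K) (hn : 0 < n) : exposedHull K n ⊆ K n := by
  rintro _ ⟨k, hk, ns, A, γ, hns, hA, hγ, rfl⟩
  exact hK k n hk hn ns A γ hns (fun i => (hA i).1) hγ

theorem mconj_mem_exposedHull {B : Matrix (Fin n) (Fin n) V} (hB : B ∈ exposedHull K n)
    {U : Matrix (Fin n) (Fin n) ℂ} (hU : Uᴴ * U = 1) : mconj U B ∈ exposedHull K n := by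
  obtain ⟨k, hk, ns, A, γ, hns, hA, hγ, rfl⟩ := hB
  refine ⟨k, hk, ns, A, fun i => γ i * U, hns, hA, ?_, ?_⟩
  · simp only [Matrix.conjTranspose_mul, Matrix.mul_assoc]
    simp only [← Matrix.mul_assoc _ _ U, ← Matrix.mul_sum, ← Matrix.sum_mul, hγ]
    rw [Matrix.mul_one, hU]
  · simp only [mconj_sum, mconj_mconj]

theorem mem_gammaImage_of_mem_convexHull (hK : IsMatrixConvex K) (hn : 0 < n)
    {P : Matrix (Fin n) (Fin n) ℂ × Matrix (Fin n) (Fin n) V}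
    (hP : P ∈ convexHull ℝ ((gammaImage (K n)).exposedPoints ℝ)) (hdet : P.1.det ≠ 0) :
    P ∈ gammaImage (exposedHull K n) := by
  obtain ⟨ι, _, w, z, hw0, hw1, hz, rfl⟩ := mem_convexHull_iff_exists_fintype.1 hP
  choose m hm A hA hexp δ hδ using fun i => exists_isMatrixExposed_of_mem_exposedPoints hK hn (hz i)
  have htr : ∀ i, ((δ i)ᴴ * δ i).trace = 1 := by
    intro i
    obtain ⟨⟨γ, B⟩, ⟨hγ, -⟩, h⟩ := (hz i).1
    rw [hδ i] at h
    exact (Prod.mk.inj h).1 ▸ hγ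
  let γ : ∀ i, Matrix (Fin (m i)) (Fin n) ℂ := fun i => ((√(w i) : ℝ) : ℂ) • δ i
  have hsum : ∑ i, w i • z i = (∑ i, (γ i)ᴴ * γ i, ∑ i, mconj (γ i) (A i)) := by
    refine Prod.ext ?_ ?_
    · rw [Prod.fst_sum]
      refine Finset.sum_congr rfl fun i _ => ?_
      rw [smul_conjTranspose_mul_smul_self, Real.sq_sqrt (hw0 i), hδ i, Prod.smul_fst]
    · rw [Prod.snd_sum]
      refine Finset.sum_congr rfl fun i _ => ?_
      rw [mconj_ofReal_smul, Real.sq_sqrt (hw0 i), hδ i, Prod.smul_snd]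
  rw [hsum] at hdet ⊢
  have htrace : (∑ i, (γ i)ᴴ * γ i).trace = 1 := by
    rw [Matrix.trace_sum]
    simp only [γ, smul_conjTranspose_mul_smul_self, Matrix.trace_smul, htr, Real.sq_sqrt (hw0 _)]
    rw [← Finset.sum_smul, hw1, one_smul]
  obtain ⟨R, hR⟩ := exists_conjTranspose_mul_self_eq
    (Matrix.posSemidef_sum Finset.univ fun i _ => Matrix.posSemidef_conjTranspose_mul_self (γ i))
  have hRdet : IsUnit R.det := by
    rw [isUnit_iff_ne_zero]
    intro h
    simp only [hR, Matrix.det_mul, h, mul_zero, ne_eq, not_true_eq_false] at hdet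
  have hRR : R⁻¹ * R = 1 := Matrix.nonsing_inv_mul R hRdet
  have hRR' : R * R⁻¹ = 1 := Matrix.mul_nonsing_inv R hRdet
  let e := Fintype.equivFin ι
  have hcard : 0 < Fintype.card ι := by
    rw [Fintype.card_pos_iff]
    by_contra h
    rw [not_nonempty_iff] at h
    simp at hw1
  rw [hR] at htrace
  refine ⟨(R, ∑ i, mconj (γ i * R⁻¹) (A i)), ⟨htrace, Fintype.card ι, hcard,
    fun j => m (e.symm j), fun j => A (e.symm j), fun j => γ (e.symm j) * R⁻¹,
    fun j => hm _, fun j => ⟨hA _, hexp _⟩, ?_, ?_⟩, ?_⟩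
  · rw [e.symm.sum_comp fun i => (γ i * R⁻¹)ᴴ * (γ i * R⁻¹)]
    have : ∀ i, (γ i * R⁻¹)ᴴ * (γ i * R⁻¹) = (R⁻¹)ᴴ * ((γ i)ᴴ * γ i) * R⁻¹ := fun i => by
      rw [Matrix.conjTranspose_mul]
      simp only [Matrix.mul_assoc]
    simp only [this]
    rw [← Matrix.sum_mul, ← Matrix.mul_sum, hR, ← Matrix.mul_assoc, ← Matrix.conjTranspose_mul,
      hRR', Matrix.conjTranspose_one, Matrix.one_mul, hRR']
  · rw [e.symm.sum_comp fun i => mconj (γ i * R⁻¹) (A i)]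
  · simp only [mconj_sum, mconj_mconj, Matrix.mul_assoc, hRR, Matrix.mul_one, ← hR]

theorem subset_closure_convexHull_exposedPoints_gammaImage
    {S : Set (Matrix (Fin n) (Fin n) V)} (hS : IsCompact S) :
    gammaImage S ⊆ closure (convexHull ℝ ((gammaImage S).exposedPoints ℝ)) := by
  have : LocallyConvexSpace ℝ (Matrix (Fin n) (Fin n) V) :=
    inferInstanceAs (LocallyConvexSpace ℝ (Fin n → Fin n → V))
  have : LocallyConvexSpace ℝ (Matrix (Fin n) (Fin n) ℂ) :=
    inferInstanceAs (LocallyConvexSpace ℝ (Fin n → Fin n → ℂ))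
  let T : (Matrix (Fin n) (Fin n) ℂ × Matrix (Fin n) (Fin n) V) →L[ℝ]
      ((Fin n → Fin n → ℂ) × (Fin n → Fin n → V)) := by
    exact ContinuousLinearMap.id ℝ ((Fin n → Fin n → ℂ) × (Fin n → Fin n → V))
  have hT : Function.Injective T := fun _ _ h => h
  exact (isCompact_gammaImage hS).subset_closure_convexHull_exposedPoints T hT

theorem subset_closure_exposedHull (hK : IsMatrixConvex K)
    (hcomp : IsCompact (K n)) (hn : 0 < n) : K n ⊆ closure (exposedHull K n) := by
  intro B hB
  have hn' : (0 : ℝ) < n := by exact_mod_cast hn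
  have hmem : ((n : ℝ)⁻¹ • (1 : Matrix (Fin n) (Fin n) ℂ), (n : ℝ)⁻¹ • B) ∈ gammaImage (K n) := by
    have := inv_smul_mem_gammaImage hB (γ := 1) hn' (by simp)
    rwa [mconj_one, Matrix.conjTranspose_one, Matrix.one_mul] at this
  have hopen : IsOpen {P : Matrix (Fin n) (Fin n) ℂ × Matrix (Fin n) (Fin n) V | P.1.det ≠ 0} :=
    isOpen_ne_fun (by fun_prop) continuous_const
  have hdet : ((n : ℝ)⁻¹ • (1 : Matrix (Fin n) (Fin n) ℂ)).det ≠ 0 := by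
    rw [← Complex.coe_smul, Matrix.det_smul]
    simp [hn.ne']
  have hM : IsCompact (closure (exposedHull K n)) := hcomp.of_isClosed_subset isClosed_closure
    (closure_minimal (exposedHull_subset hK hn) hcomp.isClosed)
  have hsub : {P : Matrix (Fin n) (Fin n) ℂ × Matrix (Fin n) (Fin n) V | P.1.det ≠ 0} ∩
      convexHull ℝ ((gammaImage (K n)).exposedPoints ℝ) ⊆
        gammaImage (closure (exposedHull K n)) := fun P hP =>
    Set.image_mono (Set.prod_mono_right subset_closure)
      (mem_gammaImage_of_mem_convexHull hK hn hP.2 hP.1)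
  obtain ⟨⟨R, D⟩, ⟨-, hD⟩, hRD⟩ := closure_minimal hsub (isCompact_gammaImage hM).isClosed
    (hopen.inter_closure ⟨hdet, subset_closure_convexHull_exposedPoints_gammaImage hcomp hmem⟩)
  obtain ⟨h1, h2⟩ := Prod.mk.inj hRD
  dsimp only at h1 h2
  have hU : (((√n : ℝ) : ℂ) • R)ᴴ * (((√n : ℝ) : ℂ) • R) = 1 := by
    rw [smul_conjTranspose_mul_smul_self, Real.sq_sqrt hn'.le, h1, smul_smul,
      mul_inv_cancel₀ hn'.ne', one_smul]
  have hBU : B = mconj (((√n : ℝ) : ℂ) • R) D := by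
    rw [mconj_ofReal_smul, Real.sq_sqrt hn'.le, h2, smul_smul, mul_inv_cancel₀ hn'.ne', one_smul]
  rw [hBU]
  exact map_mem_closure (continuous_mconj_right _) hD fun A hA => mconj_mem_exposedHull hA hU

theorem eq_closure_exposedHull (hK : IsMatrixConvex K)
    (hcomp : IsCompact (K n)) (hn : 0 < n) : K n = closure (exposedHull K n) :=
  (subset_closure_exposedHull hK hcomp hn).antisymm
    (closure_minimal (exposedHull_subset hK hn) hcomp.isClosed)

end MatrixHull

theorem straszewicz_klee_matrixConvex
    {V : Type*} [NormedAddCommGroup V] [NormedSpace ℂ V]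
    (K : ∀ n : ℕ, Set (Matrix (Fin n) (Fin n) V))
    (hK : IsMatrixConvex K) (hne : (K 1).Nonempty)
    (hcomp : ∀ n : ℕ, 0 < n → IsCompact (K n)) :
    (∃ (n : ℕ), 0 < n ∧ ∃ A ∈ K n, IsMatrixExposed K A) ∧
    ∀ n : ℕ, 0 < n →
      K n = closure {B : Matrix (Fin n) (Fin n) V |
        ∃ (k : ℕ), 0 < k ∧
        ∃ (ns : Fin k → ℕ) (Ai : ∀ i : Fin k, Matrix (Fin (ns i)) (Fin (ns i)) V)
          (γ : ∀ i : Fin k, Matrix (Fin (ns i)) (Fin n) ℂ),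
          (∀ i, 0 < ns i) ∧ (∀ i, Ai i ∈ K (ns i) ∧ IsMatrixExposed K (Ai i)) ∧
          (∑ i, (γ i)ᴴ * γ i) = 1 ∧ B = ∑ i, mconj (γ i) (Ai i)} := by
  refine ⟨?_, fun n hn => eq_closure_exposedHull hK (hcomp n hn) hn⟩
  rw [eq_closure_exposedHull hK (hcomp 1 one_pos) one_pos, closure_nonempty_iff] at hne
  obtain ⟨-, k, hk, ns, A, -, hns, hA, -, -⟩ := hne
  exact ⟨ns ⟨0, hk⟩, hns _, A ⟨0, hk⟩, (hA _).1, (hA _).2⟩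

end Statements
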